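/- For each n, let k(n) ≥ 2, distinct reals c_1,…,c_{k(n)} (which may depend on n), and the true color assignment y_n ∈ Ω be given, with observation T_n = G(y_n) + σ_n W_n and C_0 = min_{1≤i<j≤k(n)}(c_i−c_j)². Assume: (i) there is a constant c > 0 with |y_n^{-1}(c_i)| ≥ c·n for every i ∈ {1,…,k(n)} and every n; (ii) lim_{n→∞} log k(n)/log n = 0; (iii) sup_n ( max_{u≠v}|c_u−c_v| / min_{u≠v}|c_u−c_v| ) < ∞; (iv) there is a constant δ > 0 with σ_n² < (1−δ)·C_0·n/(4 log n) for all n. Then the probability that y_n is the unique minimizer of ‖T_n − G(x)‖_F² over all x ∈ Ω tends to 1 as n → ∞. -/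

import Mathlib

open MeasureTheory ProbabilityTheory Filter Finset

/-- The law of an `n × n` random matrix whose `n²` entries are i.i.d. standard Gaussians. -/
noncomputable def gaussMatrix (n : ℕ) : Measure (Fin n → Fin n → ℝ) :=
  Measure.pi fun _ : Fin n => Measure.pi fun _ : Fin n => gaussianReal 0 1

/-- The squared Frobenius norm of a real `n × n` matrix. -/
noncomputable def frobSq {n : ℕ} (A : Fin n → Fin n → ℝ) : ℝ := ∑ i, ∑ j, A i j ^ 2

/-- The matrix `G(x)` with entries `G(x)_{ij} = c_{x(i)} - c_{x(j)}`. -/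
noncomputable def Gmat {n k : ℕ} (c : Fin k → ℝ) (x : Fin n → Fin k) : Fin n → Fin n → ℝ :=
  fun i j => c (x i) - c (x j)

/-- The number of vertices to which `x` assigns color `i`. -/
def colorCard {n k : ℕ} (x : Fin n → Fin k) (i : Fin k) : ℕ :=
  (Finset.univ.filter fun v => x v = i).card

instance isProbabilityMeasure_gaussMatrix (n : ℕ) : IsProbabilityMeasure (gaussMatrix n) := by
  unfold gaussMatrix
  infer_instance

lemma integrable_exp_sum_pi_gaussianReal {n : ℕ} (a : Fin n → ℝ) :
    Integrable (fun w : Fin n → ℝ => Real.exp (∑ j, a j * w j))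
      (Measure.pi fun _ : Fin n => gaussianReal 0 1) := by
  simp_rw [Real.exp_sum]
  exact Integrable.fintype_prod (f := fun j t => Real.exp (a j * t))
    fun j => integrable_exp_mul_gaussianReal _

lemma integral_exp_sum_pi_gaussianReal {n : ℕ} (a : Fin n → ℝ) :
    ∫ w : Fin n → ℝ, Real.exp (∑ j, a j * w j) ∂(Measure.pi fun _ : Fin n => gaussianReal 0 1) =
      Real.exp (∑ j, a j ^ 2 / 2) := by
  simp_rw [Real.exp_sum]
  rw [integral_fintype_prod_eq_prod (f := fun j t => Real.exp (a j * t))]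
  refine Finset.prod_congr rfl fun j _ => ?_
  have h := congrFun (mgf_fun_id_gaussianReal (μ := 0) (v := 1)) (a j)
  simpa [mgf] using h

lemma integrable_exp_sum_gaussMatrix {n : ℕ} (A : Fin n → Fin n → ℝ) :
    Integrable (fun W : Fin n → Fin n → ℝ => Real.exp (∑ i, ∑ j, A i j * W i j))
      (gaussMatrix n) := by
  simp_rw [Real.exp_sum (s := Finset.univ) (f := fun i => ∑ j, A i j * _)]
  exact Integrable.fintype_prod (f := fun i (w : Fin n → ℝ) => Real.exp (∑ j, A i j * w j))
    fun i => integrable_exp_sum_pi_gaussianReal (A i)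

lemma integral_exp_sum_gaussMatrix {n : ℕ} (A : Fin n → Fin n → ℝ) :
    ∫ W, Real.exp (∑ i, ∑ j, A i j * W i j) ∂(gaussMatrix n) = Real.exp (frobSq A / 2) := by
  simp_rw [Real.exp_sum (s := Finset.univ) (f := fun i => ∑ j, A i j * _)]
  unfold gaussMatrix
  rw [integral_fintype_prod_eq_prod
    (f := fun i (w : Fin n → ℝ) => Real.exp (∑ j, A i j * w j))]
  simp_rw [integral_exp_sum_pi_gaussianReal]
  rw [← Real.exp_sum, frobSq, Finset.sum_div]
  simp_rw [Finset.sum_div]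

lemma frobSq_nonneg {n : ℕ} (A : Fin n → Fin n → ℝ) : 0 ≤ frobSq A :=
  Finset.sum_nonneg fun _ _ => Finset.sum_nonneg fun _ _ => sq_nonneg _

/-- Chernoff bound for the Gaussian linear form `⟨2 s D, W⟩`. -/
lemma gaussMatrix_real_frobSq_le {n : ℕ} (D : Fin n → Fin n → ℝ) {s τ : ℝ} (hτ : 0 < τ)
    (hs : s ^ 2 ≤ τ) :
    (gaussMatrix n).real {W | frobSq D ≤ ∑ i, ∑ j, 2 * s * D i j * W i j} ≤
      Real.exp (-(frobSq D / (8 * τ))) := by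
  have key : ∀ W : Fin n → Fin n → ℝ, 1 / (4 * τ) * ∑ i, ∑ j, 2 * s * D i j * W i j =
      ∑ i, ∑ j, (s / (2 * τ) * D i j) * W i j := by
    intro W
    simp_rw [Finset.mul_sum]
    refine Finset.sum_congr rfl fun i _ => Finset.sum_congr rfl fun j _ => ?_
    field_simp
    ring
  have hF : frobSq (fun i j => s / (2 * τ) * D i j) = (s / (2 * τ)) ^ 2 * frobSq D := by
    simp_rw [frobSq, mul_pow, Finset.mul_sum]
  refine (measure_ge_le_exp_mul_mgf (t := 1 / (4 * τ)) _ (by positivity) ?_).trans ?_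
  · simp_rw [key]
    exact integrable_exp_sum_gaussMatrix _
  · unfold mgf
    simp_rw [key]
    rw [integral_exp_sum_gaussMatrix, hF, ← Real.exp_add]
    refine Real.exp_le_exp.2 ?_
    have h0 := frobSq_nonneg D
    have h1 : (s / (2 * τ)) ^ 2 ≤ 1 / (4 * τ) := by
      rw [div_pow, div_le_div_iff₀ (by positivity) (by positivity)]
      nlinarith
    have h2 : (s / (2 * τ)) ^ 2 * frobSq D ≤ 1 / (4 * τ) * frobSq D :=
      mul_le_mul_of_nonneg_right h1 h0
    have h3 : frobSq D / (8 * τ) = 1 / (4 * τ) * frobSq D / 2 := by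
      field_simp
      ring
    rw [h3]
    linarith

lemma frobSq_sub_shift {n k : ℕ} (c : Fin k → ℝ) (x y : Fin n → Fin k) (s : ℝ)
    (W : Fin n → Fin n → ℝ) :
    frobSq (fun i j => (Gmat c y i j + s * W i j) - Gmat c x i j) =
      frobSq (fun i j => (Gmat c y i j + s * W i j) - Gmat c y i j) -
        ∑ i, ∑ j, 2 * s * (Gmat c x i j - Gmat c y i j) * W i j +
        frobSq (fun i j => Gmat c x i j - Gmat c y i j) := by
  simp_rw [frobSq, ← Finset.sum_sub_distrib, ← Finset.sum_add_distrib]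
  refine Finset.sum_congr rfl fun i _ => Finset.sum_congr rfl fun j _ => ?_
  ring

lemma sum_sum_sub_sq {n : ℕ} (d : Fin n → ℝ) :
    ∑ i, ∑ j, (d i - d j) ^ 2 = 2 * n * ∑ i, d i ^ 2 - 2 * (∑ i, d i) ^ 2 := by
  have h : ∀ i j, (d i - d j) ^ 2 = d i ^ 2 - 2 * (d i * d j) + d j ^ 2 := fun i j => by ring
  simp_rw [h, Finset.sum_add_distrib, Finset.sum_sub_distrib, ← Finset.mul_sum,
    ← Finset.sum_mul]
  simp [← Finset.mul_sum]
  ring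

lemma two_mul_card_mul_sum_sub_mean_sq {n : ℕ} (d : Fin n → ℝ) (hn : 0 < n) :
    2 * n * ∑ i, (d i - (∑ i, d i) / n) ^ 2 = 2 * n * ∑ i, d i ^ 2 - 2 * (∑ i, d i) ^ 2 := by
  have hn' : (0 : ℝ) < n := by exact_mod_cast hn
  set a : ℝ := (∑ i, d i) / n with ha
  have hs : ∑ i, d i = n * a := by
    rw [ha]
    field_simp
  have h : ∀ i, (d i - a) ^ 2 = d i ^ 2 - 2 * a * d i + a ^ 2 := fun i => by ring
  simp_rw [h, Finset.sum_add_distrib, Finset.sum_sub_distrib, ← Finset.mul_sum, hs]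
  simp
  ring

lemma frobSq_Gmat_sub {n k : ℕ} (c : Fin k → ℝ) (x y : Fin n → Fin k) :
    frobSq (fun i j => Gmat c x i j - Gmat c y i j) =
      2 * n * ∑ i, (c (x i) - c (y i)) ^ 2 - 2 * (∑ i, (c (x i) - c (y i))) ^ 2 := by
  rw [← sum_sum_sub_sq]
  refine Finset.sum_congr rfl fun i _ => Finset.sum_congr rfl fun j _ => ?_
  simp only [Gmat]
  ring

lemma card_mul_le_sum_of_forall_mem {ι : Type*} [Fintype ι] (s : Finset ι) (f : ι → ℝ) (b : ℝ)
    (hf : ∀ i, 0 ≤ f i) (hb : ∀ i ∈ s, b ≤ f i) : (s.card : ℝ) * b ≤ ∑ i, f i := by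
  calc (s.card : ℝ) * b = s.card • b := by simp
    _ ≤ ∑ i ∈ s, f i := Finset.card_nsmul_le_sum _ _ _ hb
    _ ≤ ∑ i, f i := Finset.sum_le_sum_of_subset_of_nonneg (Finset.subset_univ _) fun i _ _ => hf i

lemma le_frobSq_Gmat_sub_of_few {n k : ℕ} (c : Fin k → ℝ) (x y : Fin n → Fin k) {C : ℝ}
    (hC : ∀ i j, i ≠ j → C ≤ (c i - c j) ^ 2) :
    2 * (n - hammingDist x y) * (hammingDist x y * C) ≤
      frobSq (fun i j => Gmat c x i j - Gmat c y i j) := by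
  rw [frobSq_Gmat_sub]
  have hm : (hammingDist x y : ℝ) ≤ n := by
    exact_mod_cast (hammingDist_le_card_fintype (x := x) (y := y)).trans (by simp)
  have h1 : (hammingDist x y : ℝ) * C ≤ ∑ i, (c (x i) - c (y i)) ^ 2 :=
    card_mul_le_sum_of_forall_mem _ _ _ (fun i => sq_nonneg _) fun i hi => hC _ _ (by simpa using hi)
  have h2 : ∑ i, (c (x i) - c (y i)) =
      ∑ i ∈ Finset.univ.filter (fun i => x i ≠ y i), (c (x i) - c (y i)) := by
    refine (Finset.sum_subset (Finset.subset_univ _) fun i _ hi => ?_).symm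
    have : x i = y i := by simpa using hi
    simp [this]
  have h3 : (∑ i, (c (x i) - c (y i))) ^ 2 ≤
      hammingDist x y * ∑ i, (c (x i) - c (y i)) ^ 2 := by
    rw [h2]
    refine sq_sum_le_card_mul_sum_sq.trans ?_
    refine mul_le_mul_of_nonneg_left ?_ (by positivity)
    exact Finset.sum_le_sum_of_subset_of_nonneg (Finset.subset_univ _) fun i _ _ => sq_nonneg _
  nlinarith [mul_le_mul_of_nonneg_left h1 (sub_nonneg.2 hm)]

lemma le_frobSq_Gmat_sub {n k : ℕ} (hk : 0 < k) (c : Fin k → ℝ) (x y : Fin n → Fin k) {C r : ℝ}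
    (hC0 : 0 ≤ C) (hC : ∀ i j, i ≠ j → C ≤ (c i - c j) ^ 2) (hr : 0 ≤ r) (hr1 : r ≤ 1)
    (hy : ∀ i, r * n ≤ (colorCard y i : ℝ)) :
    2 * n * (r / 16) * (hammingDist x y * C) ≤
      frobSq (fun i j => Gmat c x i j - Gmat c y i j) := by
  have : Nonempty (Fin k) := ⟨⟨0, hk⟩⟩
  rcases Nat.eq_zero_or_pos n with rfl | hn
  · simpa using frobSq_nonneg _
  have hm : (hammingDist x y : ℝ) ≤ n := by
    exact_mod_cast (hammingDist_le_card_fintype (x := x) (y := y)).trans (by simp)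
  set a : ℝ := (∑ i, (c (x i) - c (y i))) / n
  have hF : frobSq (fun i j => Gmat c x i j - Gmat c y i j) =
      2 * n * ∑ i, (c (x i) - c (y i) - a) ^ 2 := by
    rw [frobSq_Gmat_sub, two_mul_card_mul_sum_sub_mean_sq _ hn]
  rw [hF, mul_assoc]
  refine mul_le_mul_of_nonneg_left ?_ (by positivity)
  have hpos : ∀ i, 0 ≤ (c (x i) - c (y i) - a) ^ 2 := fun i => sq_nonneg _
  by_cases hcase : C ≤ 16 * a ^ 2
  · have hcl : ∃ u : Fin k, ∀ i, y i = u → C / 16 ≤ (c (x i) - c (y i) - a) ^ 2 := by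
      rcases le_total 0 a with h0 | h0
      · obtain ⟨u, hu⟩ := Finite.exists_max c
        refine ⟨u, fun i hi => ?_⟩
        have := hu (x i)
        rw [hi]
        nlinarith
      · obtain ⟨u, hu⟩ := Finite.exists_min c
        refine ⟨u, fun i hi => ?_⟩
        have := hu (x i)
        rw [hi]
        nlinarith
    obtain ⟨u, hu⟩ := hcl
    have h1 := card_mul_le_sum_of_forall_mem (Finset.univ.filter fun v => y v = u)
      (fun i => (c (x i) - c (y i) - a) ^ 2) (C / 16) hpos fun i hi => hu i (by simpa using hi)
    refine le_trans ?_ h1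
    have h2 : r * hammingDist x y ≤ (colorCard y u : ℝ) :=
      (mul_le_mul_of_nonneg_left hm hr).trans (hy u)
    calc r / 16 * (hammingDist x y * C) = r * hammingDist x y * (C / 16) := by ring
      _ ≤ _ := mul_le_mul_of_nonneg_right h2 (by positivity)
  · push Not at hcase
    have h1 : (hammingDist x y : ℝ) * (C / 16) ≤ ∑ i, (c (x i) - c (y i) - a) ^ 2 := by
      refine card_mul_le_sum_of_forall_mem _ _ _ hpos fun i hi => ?_
      have h2 := hC (x i) (y i) (by simpa using hi)
      nlinarith [sq_nonneg (c (x i) - c (y i) - 2 * a)]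
    refine le_trans ?_ h1
    calc r / 16 * (hammingDist x y * C) = r * (hammingDist x y * (C / 16)) := by ring
      _ ≤ _ := mul_le_of_le_one_left (by positivity) hr1

lemma sum_pow_hammingDist_le {n k : ℕ} (y : Fin n → Fin k) {q : ℝ} (hq : 0 ≤ q) :
    ∑ x : Fin n → Fin k, q ^ hammingDist x y ≤ (1 + k * q) ^ n := by
  have h1 : ∀ x : Fin n → Fin k, q ^ hammingDist x y = ∏ i, if x i ≠ y i then q else 1 := by
    intro x
    rw [Finset.prod_ite]
    simp [hammingDist]
  have h2 := Finset.prod_univ_sum (fun _ : Fin n => (Finset.univ : Finset (Fin k)))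
    (fun i u => if u ≠ y i then q else 1)
  simp_rw [h1]
  rw [Fintype.piFinset_univ] at h2
  rw [← h2]
  calc _ ≤ ∏ _i : Fin n, (1 + k * q) := by
        refine Finset.prod_le_prod (fun i _ => Finset.sum_nonneg fun u _ => by
          split_ifs <;> simp [hq]) fun i _ => ?_
        calc _ ≤ ∑ u : Fin k, ((if u = y i then 1 else 0) + q) := by
              refine Finset.sum_le_sum fun u _ => ?_
              by_cases h : u = y i <;> simp [h, hq]
          _ = 1 + k * q := by simp [Finset.sum_add_distrib]
    _ = (1 + k * q) ^ n := by simp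

lemma sum_erase_le {n k : ℕ} (y : Fin n → Fin k) {q R : ℝ} (hq : 0 ≤ q) (hR : 0 ≤ R)
    (p : (Fin n → Fin k) → ℝ)
    (hp : ∀ x, x ≠ y → p x ≤ q ^ hammingDist x y + R) :
    ∑ x ∈ Finset.univ.erase y, p x ≤ (Real.exp (n * (k * q)) - 1) + k ^ n * R := by
  calc _ ≤ ∑ x ∈ Finset.univ.erase y, (q ^ hammingDist x y + R) :=
        Finset.sum_le_sum fun x hx => hp x (Finset.ne_of_mem_erase hx)
    _ = ∑ x ∈ Finset.univ.erase y, q ^ hammingDist x y + ∑ x ∈ Finset.univ.erase y, R :=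
        Finset.sum_add_distrib
    _ ≤ _ := by
        refine add_le_add ?_ ?_
        · have h1 := Finset.add_sum_erase Finset.univ (fun x => q ^ hammingDist x y)
            (Finset.mem_univ y)
          have h2 := sum_pow_hammingDist_le y hq
          have h3 : (1 + k * q) ^ n ≤ Real.exp (n * (k * q)) := by
            rw [Real.exp_nat_mul]
            refine pow_le_pow_left₀ (by positivity) ?_ n
            linarith [Real.add_one_le_exp (k * q)]
          simp only [hammingDist_self, pow_zero] at h1
          linarith
        · calc _ ≤ ∑ _x : Fin n → Fin k, R :=
                Finset.sum_le_sum_of_subset_of_nonneg (Finset.subset_univ _) fun _ _ _ => hR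
            _ = k ^ n * R := by simp

/-- Union bound for the failure of recovery, given the exponential bound on each competitor. -/
lemma one_sub_le_gaussMatrix_unique_min {n k : ℕ} (c : Fin k → ℝ) (y : Fin n → Fin k) {s τ B : ℝ}
    (hτ : 0 < τ) (hs : s ^ 2 ≤ τ)
    (hB : ∑ x ∈ Finset.univ.erase y,
      Real.exp (-(frobSq (fun i j => Gmat c x i j - Gmat c y i j) / (8 * τ))) ≤ B) :
    1 - ENNReal.ofReal B ≤ gaussMatrix n
      {W | ∀ x : Fin n → Fin k, x ≠ y →
        frobSq (fun i j => (Gmat c y i j + s * W i j) - Gmat c y i j) <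
        frobSq (fun i j => (Gmat c y i j + s * W i j) - Gmat c x i j)} := by
  set S := {W : Fin n → Fin n → ℝ | ∀ x : Fin n → Fin k, x ≠ y →
        frobSq (fun i j => (Gmat c y i j + s * W i j) - Gmat c y i j) <
        frobSq (fun i j => (Gmat c y i j + s * W i j) - Gmat c x i j)} with hS
  let D : (Fin n → Fin k) → Fin n → Fin n → ℝ := fun x i j => Gmat c x i j - Gmat c y i j
  let T : (Fin n → Fin k) → Set (Fin n → Fin n → ℝ) :=
    fun x => {W | frobSq (D x) ≤ ∑ i, ∑ j, 2 * s * D x i j * W i j}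
  have hsub : Sᶜ ⊆ ⋃ x ∈ Finset.univ.erase y, T x := by
    intro W hW
    simp only [hS, Set.mem_compl_iff, Set.mem_ofPred_eq, not_forall, not_lt] at hW
    obtain ⟨x, hx, h⟩ := hW
    rw [frobSq_sub_shift] at h
    simp only [Set.mem_iUnion]
    refine ⟨x, by simpa using hx, ?_⟩
    change frobSq (D x) ≤ ∑ i, ∑ j, 2 * s * D x i j * W i j
    simp only [D]
    linarith
  have hbad : gaussMatrix n Sᶜ ≤ ENNReal.ofReal B := by
    rw [← ofReal_measureReal]
    refine ENNReal.ofReal_le_ofReal ?_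
    calc _ ≤ (gaussMatrix n).real (⋃ x ∈ Finset.univ.erase y, T x) :=
          measureReal_mono hsub (measure_ne_top _ _)
      _ ≤ ∑ x ∈ Finset.univ.erase y, (gaussMatrix n).real (T x) :=
          measureReal_biUnion_finset_le _ _
      _ ≤ _ := Finset.sum_le_sum fun x _ => gaussMatrix_real_frobSq_le (D x) hτ hs
      _ ≤ B := hB
  rw [tsub_le_iff_right]
  calc (1 : ENNReal) = gaussMatrix n Set.univ := measure_univ.symm
    _ = gaussMatrix n (S ∪ Sᶜ) := by rw [Set.union_compl_self]
    _ ≤ gaussMatrix n S + gaussMatrix n Sᶜ := measure_union_le _ _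
    _ ≤ _ := by gcongr

/-- The bound on the exponent of a competitor, split according to its Hamming distance to `y`. -/
lemma exp_neg_frobSq_le {n k : ℕ} (hk : 0 < k) (c : Fin k → ℝ) (x y : Fin n → Fin k)
    {C r δ L : ℝ} (hn : 0 < n) (hC0 : 0 < C) (hC : ∀ i j, i ≠ j → C ≤ (c i - c j) ^ 2)
    (hr : 0 ≤ r) (hr1 : r ≤ 1) (hy : ∀ i, r * n ≤ (colorCard y i : ℝ))
    (hδ : 0 < δ) (hδ1 : δ < 1) (hL : 0 < L) :
    Real.exp (-(frobSq (fun i j => Gmat c x i j - Gmat c y i j) /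
        (8 * ((1 - δ) * C * n / (4 * L))))) ≤
      Real.exp (-((1 + δ / 2) * L)) ^ hammingDist x y + Real.exp (n * -(δ * r / 32 * L)) := by
  have hn' : (0 : ℝ) < n := by exact_mod_cast hn
  have hδ' : 0 < 1 - δ := by linarith
  set F := frobSq (fun i j => Gmat c x i j - Gmat c y i j)
  set m : ℝ := (hammingDist x y : ℝ)
  have hm0 : 0 ≤ m := by positivity
  have gen : ∀ t : ℝ, 2 * n * t * (m * C) ≤ F →
      m * (t / (1 - δ)) * L ≤ F / (8 * ((1 - δ) * C * n / (4 * L))) := by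
    intro t ht
    rw [le_div_iff₀ (by positivity)]
    calc m * (t / (1 - δ)) * L * (8 * ((1 - δ) * C * n / (4 * L))) = 2 * n * t * (m * C) := by
          field_simp
          ring
      _ ≤ F := ht
  by_cases hcase : m ≤ δ / 2 * n
  · refine le_trans ?_ (le_add_of_nonneg_right (Real.exp_pos _).le)
    rw [← Real.exp_nat_mul]
    refine Real.exp_le_exp.2 ?_
    have h1 := gen (1 - δ / 2) (by
      have h := le_frobSq_Gmat_sub_of_few c x y hC
      have h2 : (n : ℝ) * (1 - δ / 2) ≤ n - m := by linarith
      have h3 := mul_le_mul_of_nonneg_right h2 (by positivity : 0 ≤ m * C)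
      linarith)
    have h2 : 1 + δ / 2 ≤ (1 - δ / 2) / (1 - δ) := by
      rw [le_div_iff₀ hδ']
      nlinarith
    have h3 : m * (1 + δ / 2) * L ≤ m * ((1 - δ / 2) / (1 - δ)) * L := by gcongr
    linarith
  · push Not at hcase
    refine le_trans ?_ (le_add_of_nonneg_left (by positivity))
    refine Real.exp_le_exp.2 ?_
    have h1 := gen (r / 16) (le_frobSq_Gmat_sub hk c x y hC0.le hC hr hr1 hy)
    have h2 : r / 16 ≤ r / 16 / (1 - δ) := by
      rw [le_div_iff₀ hδ']
      nlinarith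
    have h3 : δ / 2 * n * (r / 16) * L ≤ m * (r / 16 / (1 - δ)) * L := by gcongr
    linarith

lemma sInf_sq_sub_pos_and_le {k : ℕ} (hk : 2 ≤ k) (c : Fin k → ℝ) (hc : Function.Injective c) :
    0 < sInf {r : ℝ | ∃ i j : Fin k, i < j ∧ r = (c i - c j) ^ 2} ∧
      ∀ i j, i ≠ j → sInf {r : ℝ | ∃ i j : Fin k, i < j ∧ r = (c i - c j) ^ 2} ≤
        (c i - c j) ^ 2 := by
  set S := {r : ℝ | ∃ i j : Fin k, i < j ∧ r = (c i - c j) ^ 2} with hS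
  have hfin : S.Finite := by
    refine (Set.finite_range fun p : Fin k × Fin k => (c p.1 - c p.2) ^ 2).subset ?_
    rintro r ⟨i, j, -, rfl⟩
    exact ⟨(i, j), rfl⟩
  have hne : S.Nonempty := ⟨_, ⟨0, by lia⟩, ⟨1, by lia⟩, by simp [Fin.lt_def], rfl⟩
  constructor
  · obtain ⟨i, j, hij, h⟩ := hne.csInf_mem hfin
    rw [h]
    have : c i - c j ≠ 0 := sub_ne_zero.2 (hc.ne hij.ne)
    positivity
  · intro i j hij
    rcases lt_or_gt_of_ne hij with h | h
    · exact csInf_le hfin.bddBelow ⟨i, j, h, rfl⟩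
    · exact csInf_le hfin.bddBelow ⟨j, i, h, by ring⟩

lemma mul_le_one_of_colorCard {n k : ℕ} (hn : 0 < n) (y : Fin n → Fin k) {r : ℝ}
    (hy : ∀ i, r * n ≤ (colorCard y i : ℝ)) : k * r ≤ 1 := by
  have hn' : (0 : ℝ) < n := by exact_mod_cast hn
  have h1 : ∑ i : Fin k, colorCard y i = n := by
    have := Finset.card_eq_sum_card_fiberwise (f := y) (s := Finset.univ) (t := Finset.univ)
      (fun _ _ => by simp)
    simpa [colorCard] using this.symm
  have h2 : ∑ _i : Fin k, r * n ≤ ∑ i : Fin k, (colorCard y i : ℝ) :=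
    Finset.sum_le_sum fun i _ => hy i
  rw [← Nat.cast_sum, h1] at h2
  simp only [Finset.sum_const, Finset.card_univ, Fintype.card_fin, nsmul_eq_mul] at h2
  nlinarith

lemma tendsto_failure_bound (K δ η : ℝ) (hK : 0 < K) (hδ : 0 < δ) (hη : 0 < η) :
    Tendsto (fun n : ℕ => (Real.exp (n * (K * Real.exp (-((1 + δ / 2) * Real.log n)))) - 1) +
      K ^ n * Real.exp (n * -(η * Real.log n))) atTop (nhds 0) := by
  have hlog : Tendsto (fun n : ℕ => Real.log n) atTop atTop :=
    Real.tendsto_log_atTop.comp tendsto_natCast_atTop_atTop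
  have h1 : Tendsto (fun n : ℕ => K * Real.exp (-(δ / 2 * Real.log n))) atTop (nhds 0) := by
    have := (Real.tendsto_exp_neg_atTop_nhds_zero.comp
      (hlog.const_mul_atTop (by positivity : 0 < δ / 2))).const_mul K
    simpa using this
  have h2 : Tendsto (fun n : ℕ => Real.exp (K * Real.exp (-(δ / 2 * Real.log n))) - 1)
      atTop (nhds 0) := by
    have := ((Real.continuous_exp.tendsto 0).comp h1).sub_const 1
    simpa using this
  have h3 : Tendsto (fun n : ℕ => Real.exp (-(n * (η * Real.log n - Real.log K))))
      atTop (nhds 0) := by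
    refine Real.tendsto_exp_neg_atTop_nhds_zero.comp ?_
    refine Tendsto.atTop_mul_atTop₀ tendsto_natCast_atTop_atTop ?_
    exact tendsto_atTop_add_const_right _ _ (hlog.const_mul_atTop hη)
  have h4 := h2.add h3
  rw [add_zero] at h4
  refine h4.congr' ?_
  filter_upwards [eventually_gt_atTop 0] with n hn
  have hn' : (0 : ℝ) < n := by exact_mod_cast hn
  congr 1
  · congr 2
    rw [show -((1 + δ / 2) * Real.log n) = -(δ / 2 * Real.log n) + -Real.log n by ring,
      Real.exp_add, Real.exp_neg (Real.log n), Real.exp_log hn']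
    field_simp
  · rw [show -(n * (η * Real.log n - Real.log K)) =
      n * Real.log K + n * -(η * Real.log n) by ring, Real.exp_add, Real.exp_nat_mul,
      Real.exp_log hK]

lemma eventually_le_of_log_div_log_tendsto_zero (k : ℕ → ℕ) (hk : ∀ n, 2 ≤ k n)
    (h : Tendsto (fun n : ℕ => Real.log (k n) / Real.log n) atTop (nhds 0)) :
    ∀ᶠ n in atTop, k n ≤ n := by
  filter_upwards [h.eventually_lt_const one_pos, eventually_ge_atTop 2] with n h1 hn
  have hn' : (1 : ℝ) < n := by exact_mod_cast hn
  rw [div_lt_one (Real.log_pos hn')] at h1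
  have hk' : (0 : ℝ) < k n := by exact_mod_cast two_pos.trans_le (hk n)
  exact_mod_cast ((Real.log_lt_log_iff hk' (by linarith)).1 h1).le

theorem exact_recovery_G_free_sizes_subcritical
    (k : ℕ → ℕ) (hk : ∀ n : ℕ, 2 ≤ k n)
    (c : (n : ℕ) → Fin (k n) → ℝ) (hc : ∀ n : ℕ, Function.Injective (c n))
    (C0 : ℕ → ℝ)
    (hC0 : ∀ n : ℕ, C0 n = sInf {r : ℝ | ∃ i j : Fin (k n), i < j ∧ r = (c n i - c n j) ^ 2})
    (y : (n : ℕ) → Fin n → Fin (k n))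
    (cl : ℝ) (hcl : 0 < cl)
    (hfiber : ∀ n : ℕ, k n ≤ n → ∀ i : Fin (k n), cl * n ≤ (colorCard (y n) i : ℝ))
    (hklog : Tendsto (fun n : ℕ => Real.log (k n) / Real.log n) atTop (nhds 0))
    (M : ℝ)
    (hratio : ∀ n : ℕ, k n ≤ n → ∀ u w u' w' : Fin (k n), u ≠ w → u' ≠ w' →
      |c n u - c n w| ≤ M * |c n u' - c n w'|)
    (σ : ℕ → ℝ) (δ : ℝ) (hδ : 0 < δ)
    (hσ : ∀ n : ℕ, k n ≤ n → σ n ^ 2 < (1 - δ) * C0 n * n / (4 * Real.log n)) :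
    Tendsto (fun n : ℕ => gaussMatrix n
        {W | ∀ x : Fin n → Fin (k n), x ≠ y n →
          frobSq (fun i j => (Gmat (c n) (y n) i j + σ n * W i j) - Gmat (c n) (y n) i j) <
          frobSq (fun i j => (Gmat (c n) (y n) i j + σ n * W i j) - Gmat (c n) x i j)})
      atTop (nhds 1) := by
  have hev := eventually_le_of_log_div_log_tendsto_zero k hk hklog
  have hlim := tendsto_failure_bound (1 / cl) δ (δ * cl / 32) (by positivity) hδ (by positivity)
  have hlow := ENNReal.Tendsto.sub (tendsto_const_nhds (x := (1 : ENNReal)))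
    (ENNReal.tendsto_ofReal hlim) (Or.inl ENNReal.one_ne_top)
  rw [ENNReal.ofReal_zero, tsub_zero] at hlow
  refine tendsto_of_tendsto_of_tendsto_of_le_of_le' hlow tendsto_const_nhds ?_
    (Eventually.of_forall fun n => prob_le_one)
  filter_upwards [hev, eventually_ge_atTop 2] with n hkn hn
  have hn0 : 0 < n := by lia
  have hn' : (0 : ℝ) < n := by exact_mod_cast hn0
  have hL : 0 < Real.log n := Real.log_pos (by exact_mod_cast hn)
  obtain ⟨hCpos, hCle⟩ := sInf_sq_sub_pos_and_le (hk n) (c n) (hc n)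
  rw [← hC0 n] at hCpos hCle
  have hs := hσ n hkn
  have hτ : 0 < (1 - δ) * C0 n * n / (4 * Real.log n) := (sq_nonneg _).trans_lt hs
  have hδ1 : δ < 1 := by
    rw [div_pos_iff_of_pos_right (by positivity), mul_assoc,
      mul_pos_iff_of_pos_right (by positivity)] at hτ
    linarith
  have hkcl := mul_le_one_of_colorCard hn0 (y n) (hfiber n hkn)
  have hk2 : (2 : ℝ) ≤ k n := by exact_mod_cast hk n
  have hcl1 : cl ≤ 1 := by nlinarith
  have hkK : (k n : ℝ) ≤ 1 / cl := by rwa [le_div_iff₀ hcl]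
  refine one_sub_le_gaussMatrix_unique_min (c n) (y n) hτ hs.le ?_
  refine (sum_erase_le (y n) (Real.exp_pos _).le (Real.exp_pos _).le _ fun x _ =>
    exp_neg_frobSq_le (two_pos.trans_le (hk n)) (c n) x (y n) hn0 hCpos hCle hcl.le hcl1
      (hfiber n hkn) hδ hδ1 hL).trans ?_
  gcongr
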